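/- Let T > 0 be real, m ≥ 1 a natural number, τ ≥ 0, and let S = ⋃_{i=0}^{m−1} {τ + i·(T/m) + j·T : j ∈ ℕ} ⊆ ℝ. Then for every s ∈ S, the infimum of {s' ∈ S : s' > s} equals s + T/m, and s + T/m ∈ S. Hence if a node that is visited exactly once per cycle of period T by a single team is patrolled by m such teams uniformly offset by T/m, the time between consecutive visits to the node is exactly T/m. -/

import Mathlib

/-- Let `S = ⋃_{i=0}^{m−1} {τ + i·(T/m) + j·T : j ∈ ℕ}` be the collective
visit-time set of a node visited exactly once per cycle of period `T` by each of
`m` teams uniformly offset by `T/m`. Then for every `s ∈ S`, the next visit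
occurs exactly at `s + T/m`: `s + T/m ∈ S` and the infimum of the visit times
after `s` is `s + T/m`. Hence the time between consecutive visits is exactly `T/m`. -/
theorem next_visit_with_m_teams (T : ℝ) (hT : 0 < T) (m : ℕ) (hm : 1 ≤ m) (τ : ℝ)
    (hτ : 0 ≤ τ) :
    ∀ s ∈ (⋃ i ∈ Finset.range m,
        {x : ℝ | ∃ j : ℕ, x = τ + (i : ℝ) * (T / (m : ℝ)) + (j : ℝ) * T}),
      sInf {x ∈ (⋃ i ∈ Finset.range m,
          {x : ℝ | ∃ j : ℕ, x = τ + (i : ℝ) * (T / (m : ℝ)) + (j : ℝ) * T}) | s < x}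
        = s + T / (m : ℝ) ∧
      s + T / (m : ℝ) ∈ (⋃ i ∈ Finset.range m,
        {x : ℝ | ∃ j : ℕ, x = τ + (i : ℝ) * (T / (m : ℝ)) + (j : ℝ) * T}) := by
  have hm0 : (0 : ℝ) < (m : ℝ) := by exact_mod_cast hm
  have hd : 0 < T / (m : ℝ) := div_pos hT hm0
  have key : (⋃ i ∈ Finset.range m,
        {x : ℝ | ∃ j : ℕ, x = τ + (i : ℝ) * (T / (m : ℝ)) + (j : ℝ) * T})
      = {x : ℝ | ∃ k : ℕ, x = τ + (k : ℝ) * (T / (m : ℝ))} := by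
    ext x
    simp only [Set.mem_iUnion, Finset.mem_range, Set.mem_setOf_eq, exists_prop]
    constructor
    · rintro ⟨i, _, j, rfl⟩
      refine ⟨i + j * m, ?_⟩
      push_cast
      field_simp
      ring
    · rintro ⟨k, rfl⟩
      refine ⟨k % m, Nat.mod_lt _ hm, k / m, ?_⟩
      have h : (k : ℝ) = ((k % m : ℕ) : ℝ) + (m : ℝ) * ((k / m : ℕ) : ℝ) := by
        exact_mod_cast (Nat.mod_add_div k m).symm
      have h2 : (m : ℝ) * (T / (m : ℝ)) = T := by field_simp
      calc τ + (k : ℝ) * (T / (m : ℝ))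
          = τ + (((k % m : ℕ) : ℝ) + (m : ℝ) * ((k / m : ℕ) : ℝ)) * (T / (m : ℝ)) := by rw [← h]
        _ = τ + ((k % m : ℕ) : ℝ) * (T / (m : ℝ))
            + ((k / m : ℕ) : ℝ) * ((m : ℝ) * (T / (m : ℝ))) := by ring
        _ = _ := by rw [h2]
  rw [key]
  rintro s ⟨k, rfl⟩
  have hmem : τ + (k : ℝ) * (T / (m : ℝ)) + T / (m : ℝ)
      ∈ {x : ℝ | ∃ k : ℕ, x = τ + (k : ℝ) * (T / (m : ℝ))} :=
    ⟨k + 1, by push_cast; ring⟩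
  refine ⟨IsLeast.csInf_eq ⟨⟨hmem, by linarith⟩, ?_⟩, hmem⟩
  rintro x ⟨⟨l, rfl⟩, hl⟩
  have h1 : (k : ℝ) < l := lt_of_mul_lt_mul_right (by linarith) hd.le
  have h2 : (k : ℝ) + 1 ≤ l := by exact_mod_cast h1
  have h3 := mul_le_mul_of_nonneg_right h2 hd.le
  linarith
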